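/- arXiv:2512.15507 — 2 statements merged into one kernel-verified Lean document; each statement's English description precedes it below -/
import Mathlib

section
/- Let k ≥ 2 be an integer, let γ be a real number with 0 < γ ≤ 1/k, and let r : {1,…,k} → ℝ. Then V* = (1 − (k − |J*|)γ)·max_j r(j) + γ·Σ_{j ∉ J*} r(j) is the greatest value of the linear objective Σ_{j=1}^k π_j r(j) over the feasible set Π; that is, Σ_{j=1}^k π_j r(j) ≤ V* for every π ∈ Π, and V* is attained by some π ∈ Π. -/
open Finset

/-- If `f` is constantly `M` on `J`, its sum is `#J * M` plus the sum off `J`. -/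
theorem sum_eq_card_mul_add_sum_sdiff {ι : Type*} [Fintype ι] [DecidableEq ι]
    (J : Finset ι) (f : ι → ℝ) (M : ℝ) (hJ : ∀ j ∈ J, f j = M) :
    ∑ j, f j = (J.card : ℝ) * M + ∑ j ∈ Finset.univ \ J, f j := by
  rw [← Finset.sum_sdiff (Finset.subset_univ J), Finset.sum_congr rfl hJ,
    Finset.sum_const, nsmul_eq_mul, add_comm]

/-- A weighted sum with weights at least `γ` and total weight one is bounded by putting
the weight `γ` everywhere and the remaining mass on an upper bound of the values. -/
theorem sum_mul_le_of_le_weight {ι : Type*} [Fintype ι] (γ M : ℝ) (r π : ι → ℝ)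
    (hr : ∀ j, r j ≤ M) (hsum : ∑ j, π j = 1) (hπ : ∀ j, γ ≤ π j) :
    ∑ j, π j * r j ≤ (1 - Fintype.card ι * γ) * M + γ * ∑ j, r j :=
  calc ∑ j, π j * r j ≤ ∑ j, ((π j - γ) * M + γ * r j) :=
        Finset.sum_le_sum fun j _ => by
          nlinarith [mul_nonneg (sub_nonneg.2 (hπ j)) (sub_nonneg.2 (hr j))]
    _ = (1 - Fintype.card ι * γ) * M + γ * ∑ j, r j := by
        rw [Finset.sum_add_distrib, ← Finset.sum_mul, ← Finset.mul_sum,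
          Finset.sum_sub_distrib, hsum, Finset.sum_const, nsmul_eq_mul, Finset.card_univ]

/-- Theorem 1(1): the optimal value of the average reward over the
γ-constrained simplex is
`V* = (1 - (k - |J*|)γ) * max_j r(j) + γ * ∑_{j ∉ J*} r(j)`. -/
theorem optimal_value_average_reward
    (k : ℕ) (hk : 2 ≤ k) (γ : ℝ) (hγ0 : 0 < γ) (hγk : γ ≤ 1 / k)
    (r : Fin k → ℝ)
    (M : ℝ) (hM : M = Finset.univ.sup' ⟨(⟨0, by omega⟩ : Fin k), Finset.mem_univ _⟩ r)
    (Jstar : Finset (Fin k)) (hJ : Jstar = Finset.univ.filter fun j => r j = M)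
    (V : ℝ)
    (hV : V = (1 - ((k : ℝ) - (Jstar.card : ℝ)) * γ) * M
            + γ * ∑ j ∈ Finset.univ \ Jstar, r j) :
    (∀ π : Fin k → ℝ, (∑ j, π j = 1) → (∀ j, γ ≤ π j ∧ π j ≤ 1 - γ) →
        ∑ j, π j * r j ≤ V) ∧
    (∃ π : Fin k → ℝ, (∑ j, π j = 1) ∧ (∀ j, γ ≤ π j ∧ π j ≤ 1 - γ) ∧
        ∑ j, π j * r j = V) := by
  have hr : ∀ j, r j ≤ M := fun j => hM ▸ Finset.le_sup' r (Finset.mem_univ j)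
  obtain ⟨i, -, hi⟩ := Finset.exists_mem_eq_sup'
    (⟨(⟨0, by omega⟩ : Fin k), Finset.mem_univ _⟩ : (Finset.univ : Finset (Fin k)).Nonempty) r
  rw [← hM] at hi
  have hV' : V = (1 - k * γ) * M + γ * ∑ j, r j := by
    rw [hV, sum_eq_card_mul_add_sum_sdiff Jstar r M fun j hj => by simpa [hJ] using hj]
    ring
  have hk' : (2 : ℝ) ≤ k := by exact_mod_cast hk
  have hkγ : k * γ ≤ 1 := by
    rw [mul_comm]
    exact (le_div_iff₀ (by linarith)).1 hγk
  have h2γ : 2 * γ ≤ k * γ := by gcongr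
  refine ⟨fun π hsum hπ => ?_, fun j => γ + if j = i then 1 - k * γ else 0, ?_, fun j => ?_, ?_⟩
  · rw [hV']
    simpa using sum_mul_le_of_le_weight γ M r π hr hsum fun j => (hπ j).1
  · simp [Finset.sum_add_distrib]
  · dsimp only
    split_ifs <;> constructor <;> linarith
  · simp [hV', hi, add_mul, Finset.sum_add_distrib, ← Finset.mul_sum, add_comm]
end

section
/- Let k be a positive integer and γ a real number with 0 ≤ γ and kγ ≤ 1. Let π = (π_1,…,π_k) and π' = (π'_1,…,π'_k) be probability vectors (nonnegative entries summing to 1) with π_j ≥ γ and π'_j ≥ γ for all j, and let c_1,…,c_k be real numbers with m ≤ c_j ≤ M for all j. Then |Σ_{j=1}^k π_j c_j − Σ_{j=1}^k π'_j c_j| ≤ (1 − kγ)(M − m). -/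
open Finset

/-- A probability vector with entries at least `γ` averages values bounded by `M` to at most
`γ ∑ c_j + (1 - kγ) M`. -/
theorem sum_mul_le_of_forall_le {ι : Type*} [Fintype ι] {γ M : ℝ} {p c : ι → ℝ}
    (hp : ∑ j, p j = 1) (hγ : ∀ j, γ ≤ p j) (hc : ∀ j, c j ≤ M) :
    ∑ j, p j * c j ≤ γ * ∑ j, c j + (1 - Fintype.card ι * γ) * M := by
  have h : ∑ j, (p j - γ) * c j ≤ ∑ j, (p j - γ) * M :=
    sum_le_sum fun j _ => mul_le_mul_of_nonneg_left (hc j) (sub_nonneg.2 (hγ j))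
  rw [← sum_mul] at h
  simp only [sub_mul, sum_sub_distrib, ← mul_sum, hp, sum_const, card_univ, nsmul_eq_mul] at h
  linarith

/-- A probability vector with entries at least `γ` averages values bounded below by `m` to at least
`γ ∑ c_j + (1 - kγ) m`. -/
theorem le_sum_mul_of_forall_le {ι : Type*} [Fintype ι] {γ m : ℝ} {p c : ι → ℝ}
    (hp : ∑ j, p j = 1) (hγ : ∀ j, γ ≤ p j) (hc : ∀ j, m ≤ c j) :
    γ * ∑ j, c j + (1 - Fintype.card ι * γ) * m ≤ ∑ j, p j * c j := by
  have h := sum_mul_le_of_forall_le hp hγ fun j => neg_le_neg (hc j)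
  simp only [mul_neg, sum_neg_distrib] at h
  linarith

/-- Span-seminorm contraction estimate: for two γ-constrained sampling
probability vectors and values `c_j ∈ [m, M]`,
`|∑ π_j c_j − ∑ π'_j c_j| ≤ (1 − kγ)(M − m)`. -/
theorem span_contraction_estimate
    (k : ℕ) (hk : 0 < k) (γ : ℝ) (hγ : 0 ≤ γ) (hkγ : (k : ℝ) * γ ≤ 1)
    (π π' c : Fin k → ℝ) (m M : ℝ)
    (hπ0 : ∀ j, 0 ≤ π j) (hπ1 : ∑ j, π j = 1) (hπγ : ∀ j, γ ≤ π j)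
    (hπ'0 : ∀ j, 0 ≤ π' j) (hπ'1 : ∑ j, π' j = 1) (hπ'γ : ∀ j, γ ≤ π' j)
    (hc : ∀ j, m ≤ c j ∧ c j ≤ M) :
    |(∑ j, π j * c j) - ∑ j, π' j * c j| ≤ (1 - (k : ℝ) * γ) * (M - m) := by
  have hu := sum_mul_le_of_forall_le hπ1 hπγ fun j => (hc j).2
  have hl := le_sum_mul_of_forall_le hπ1 hπγ fun j => (hc j).1
  have hu' := sum_mul_le_of_forall_le hπ'1 hπ'γ fun j => (hc j).2
  have hl' := le_sum_mul_of_forall_le hπ'1 hπ'γ fun j => (hc j).1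
  rw [Fintype.card_fin] at hu hl hu' hl'
  rw [abs_le, mul_sub]
  constructor <;> linarith
end
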